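/- Let ρ be a state on a finite-dimensional Hilbert space ℋ and let Y, Δ be positive semidefinite operators on ℋ such that ρ ≤ Y + Δ and tr(Δ) < 1. Then there exists a state ρ̃ on ℋ such that ρ̃ ≤ (1 − tr(Δ))^{−1} Y, F(ρ, ρ̃) ≥ 1 − tr(Δ), and ‖ρ − ρ̃‖₁ ≤ 4√(tr(Δ)). -/

import Mathlib

open scoped BigOperators
open Filter ComplexOrder

noncomputable section

namespace GQSL

variable {I : Type*} [Fintype I] [DecidableEq I]

/-- A quantum state: a positive semidefinite matrix of unit trace. -/
def IsState (ρ : Matrix I I ℂ) : Prop := ρ.PosSemidef ∧ ρ.trace = 1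

/-- The `n`-fold tensor power of an operator, realized on `Fin n → I` indices. -/
def tpow (ρ : Matrix I I ℂ) (n : ℕ) : Matrix (Fin n → I) (Fin n → I) ℂ :=
  fun x y => ∏ i, ρ (x i) (y i)

/-- Functional calculus for Hermitian matrices (junk value `0` otherwise). -/
def fcal (f : ℝ → ℝ) (A : Matrix I I ℂ) : Matrix I I ℂ :=
  if hA : A.IsHermitian then
    (hA.eigenvectorUnitary : Matrix I I ℂ) *
      Matrix.diagonal (fun i => (f (hA.eigenvalues i) : ℂ)) *
      star (hA.eigenvectorUnitary : Matrix I I ℂ)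
  else 0

/-- Base-2 matrix logarithm, computed on the support. -/
def mlog (A : Matrix I I ℂ) : Matrix I I ℂ :=
  fcal (fun x => if 0 < x then Real.logb 2 x else 0) A

/-- Real matrix power, computed on the support (generalized inverse powers). -/
def mpow (A : Matrix I I ℂ) (t : ℝ) : Matrix I I ℂ :=
  fcal (fun x => if 0 < x then x ^ t else 0) A

/-- Matrix square root of a positive semidefinite matrix. -/
def msqrt (A : Matrix I I ℂ) : Matrix I I ℂ := fcal Real.sqrt A

/-- Trace norm `‖A‖₁ = tr √(AᴴA)`. -/
def trNorm (A : Matrix I I ℂ) : ℝ := ((msqrt (A.conjTranspose * A)).trace).re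

/-- Trace of the positive part of a Hermitian matrix: the sum of its positive eigenvalues. -/
def trPos (A : Matrix I I ℂ) : ℝ := ((fcal (fun x => max x 0) A).trace).re

/-- Fidelity `F(A,B) = tr √(√A B √A)`. -/
def fid (A B : Matrix I I ℂ) : ℝ := ((msqrt (msqrt A * B * msqrt A)).trace).re

/-- Von Neumann entropy (base 2). -/
def vnEnt (A : Matrix I I ℂ) : ℝ := -((A * mlog A).trace).re

/-- `supp ρ ⊆ supp σ`, expressed via kernels. -/
def SuppLe (ρ σ : Matrix I I ℂ) : Prop := ∀ v, σ.mulVec v = 0 → ρ.mulVec v = 0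

/-- Quantum relative entropy `S(ρ‖σ) = tr(ρ(log₂ρ − log₂σ))` (finite-value formula,
meaningful when `SuppLe ρ σ` holds). -/
def relEnt (ρ σ : Matrix I I ℂ) : ℝ := ((ρ * (mlog ρ - mlog σ)).trace).re

/-- `E_M(ρ) = inf {S(ρ‖σ) : σ ∈ M}`; states `σ` violating the support condition
have `S(ρ‖σ) = +∞` and hence do not contribute to the infimum. -/
def EMset (M : Set (Matrix I I ℂ)) (ρ : Matrix I I ℂ) : ℝ :=
  sInf {x | ∃ σ ∈ M, SuppLe ρ σ ∧ x = relEnt ρ σ}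

/-- Max-relative entropy `S_max(ρ‖σ) = inf {s : ρ ≤ 2^s σ}`. -/
def Smax (ρ σ : Matrix I I ℂ) : ℝ := sInf {s : ℝ | (((2:ℝ) ^ s) • σ - ρ).PosSemidef}

/-- Log robustness with respect to a set `M`. -/
def LR (M : Set (Matrix I I ℂ)) (ρ : Matrix I I ℂ) : ℝ :=
  sInf {x | ∃ σ ∈ M, x = Smax ρ σ}

/-- Smoothed log robustness. -/
def LReps (M : Set (Matrix I I ℂ)) (ε : ℝ) (ρ : Matrix I I ℂ) : ℝ :=
  sInf {x | ∃ ρ', IsState ρ' ∧ trNorm (ρ' - ρ) ≤ ε ∧ x = LR M ρ'}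

/-- Partial trace over the `k`-th tensor factor. -/
def ptraceAt {n : ℕ} (k : Fin (n + 1)) (ρ : Matrix (Fin (n + 1) → I) (Fin (n + 1) → I) ℂ) :
    Matrix (Fin n → I) (Fin n → I) ℂ :=
  fun x y => ∑ a : I, ρ (k.insertNth a x) (k.insertNth a y)

/-- Tensor product of operators on `n` and `m` copies. -/
def tprod {n m : ℕ} (ρ : Matrix (Fin n → I) (Fin n → I) ℂ)
    (ν : Matrix (Fin m → I) (Fin m → I) ℂ) :
    Matrix (Fin (n + m) → I) (Fin (n + m) → I) ℂ :=
  fun x y => ρ (fun i => x (Fin.castAdd m i)) (fun i => y (Fin.castAdd m i)) *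
    ν (fun j => x (Fin.natAdd n j)) (fun j => y (Fin.natAdd n j))

/-- Conjugation `P_π ρ P_π†` by the permutation unitary. -/
def permute {n : ℕ} (π : Equiv.Perm (Fin n)) (ρ : Matrix (Fin n → I) (Fin n → I) ℂ) :
    Matrix (Fin n → I) (Fin n → I) ℂ :=
  fun x y => ρ (x ∘ π) (y ∘ π)

/-- A family of sets of states satisfying properties 1–5, with `σ` the fixed
full-rank state of property 2. -/
structure GoodFamily {d : ℕ} (σ : Matrix (Fin d) (Fin d) ℂ)
    (M : ∀ n : ℕ, Set (Matrix (Fin n → Fin d) (Fin n → Fin d) ℂ)) : Prop where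
  states : ∀ n, ∀ ρ ∈ M n, IsState ρ
  convex : ∀ n, Convex ℝ (M n)
  closed : ∀ n, IsClosed (M n)
  sigma_state : IsState σ
  sigma_posdef : σ.PosDef
  sigma_mem : ∀ n, tpow σ n ∈ M n
  ptrace_mem : ∀ n (k : Fin (n + 1)), ∀ ρ ∈ M (n + 1), ptraceAt k ρ ∈ M n
  tprod_mem : ∀ n m, ∀ ρ ∈ M n, ∀ ν ∈ M m, tprod ρ ν ∈ M (n + m)
  perm_mem : ∀ n (π : Equiv.Perm (Fin n)), ∀ ρ ∈ M n, permute π ρ ∈ M n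

/-- The rank-one operator `|f⟩⟨f|`. -/
def vecOp {J : Type*} (f : J → ℂ) : Matrix J J ℂ := fun x y => f x * star (f y)

/-- Squared ℓ²-norm of a vector. -/
def vecNormSq {J : Type*} [Fintype J] (f : J → ℂ) : ℝ := ∑ x, Complex.normSq (f x)

/-- ℓ²-norm of a vector. -/
def l2norm {J : Type*} [Fintype J] (f : J → ℂ) : ℝ := Real.sqrt (vecNormSq f)

/-- Membership in the symmetric subspace. -/
def IsSymVec {J : Type*} {N : ℕ} (f : (Fin N → J) → ℂ) : Prop :=
  ∀ (π : Equiv.Perm (Fin N)) (x : Fin N → J), f (x ∘ π) = f x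

/-- Unnormalized symmetrization `Σ_π P_π ψ`. -/
def symmetrize {J : Type*} {N : ℕ} (ψ : (Fin N → J) → ℂ) : (Fin N → J) → ℂ :=
  fun x => ∑ π : Equiv.Perm (Fin N), ψ (x ∘ π)

/-- Normalized symmetrization `Sym(ψ)`. -/
def SymOf {J : Type*} [Fintype J] {N : ℕ} (ψ : (Fin N → J) → ℂ) : (Fin N → J) → ℂ :=
  ((l2norm (symmetrize ψ) : ℂ))⁻¹ • symmetrize ψ

/-- Partial trace over the first `m` of `m + k` tensor factors. -/
def ptraceFirst {J : Type*} [Fintype J] [DecidableEq J] {m k : ℕ}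
    (ρ : Matrix (Fin (m + k) → J) (Fin (m + k) → J) ℂ) :
    Matrix (Fin k → J) (Fin k → J) ℂ :=
  fun x y => ∑ a : Fin m → J, ρ (Fin.append a x) (Fin.append a y)

/-- Partial trace over the environment components of `N` system–environment pairs. -/
def ptraceE {A E : Type*} [Fintype A] [Fintype E] {N : ℕ}
    (ρ : Matrix (Fin N → A × E) (Fin N → A × E) ℂ) :
    Matrix (Fin N → A) (Fin N → A) ℂ :=
  fun x y => ∑ e : Fin N → E, ρ (fun i => (x i, e i)) (fun i => (y i, e i))

/-- The set of `(N choose r)`-i.i.d. vectors along `θ`: vectors which are `θ` on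
`N − r` of the positions (the permutations of `θ^{⊗(N−r)} ⊗ ψ_r`). -/
def powVecSet {J : Type*} (θ : J → ℂ) (N r : ℕ) : Set ((Fin N → J) → ℂ) :=
  {f | ∃ S : Finset (Fin N), S.card = N - r ∧
    ∃ ψ : ({i : Fin N // i ∉ S} → J) → ℂ,
      f = fun x => (∏ i ∈ S, θ (x i)) * ψ (fun j => x j.1)}

/-- Almost power states along `θ`: `|θ⟩^{[⊗,N,r]} = Sym(ℋ^{⊗N}) ∩ span V(ℋ^{⊗N}, θ^{⊗N−r})`. -/
def almostPower {J : Type*} (θ : J → ℂ) (N r : ℕ) : Set ((Fin N → J) → ℂ) :=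
  {f | IsSymVec f ∧ f ∈ Submodule.span ℂ (powVecSet θ N r)}

/-- `η ⊗ θ^{⊗(N−k)}`: the vector `η` on the first `k` slots and `θ` on the rest. -/
def etaTensor {J : Type*} {N k : ℕ} (h : k ≤ N) (η : (Fin k → J) → ℂ) (θ : J → ℂ) :
    (Fin N → J) → ℂ :=
  fun x => η (fun i => x (Fin.castLE h i)) * ∏ i : Fin N, if (i : ℕ) < k then 1 else θ (x i)

/-- `η` lies in the `k`-fold tensor power of the orthogonal complement of `θ`:
the contraction of `η` with `⟨θ|` at any slot vanishes. -/
def InPerpPow {J : Type*} [Fintype J] [DecidableEq J] {k : ℕ} (θ : J → ℂ)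
    (η : (Fin k → J) → ℂ) : Prop :=
  ∀ (j : Fin k) (z : Fin k → J), ∑ a : J, star (θ a) * η (Function.update z j a) = 0

/-- Binary Shannon entropy. -/
def binEnt (x : ℝ) : ℝ := -(x * Real.logb 2 x) - (1 - x) * Real.logb 2 (1 - x)

/-- Product operator `σ₁ ⊗ ⋯ ⊗ σ_k` of a `k`-partite system. -/
def prodOp {k : ℕ} {ι : Fin k → Type*} [∀ i, Fintype (ι i)]
    (σs : ∀ i, Matrix (ι i) (ι i) ℂ) : Matrix (∀ i, ι i) (∀ i, ι i) ℂ :=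
  fun x y => ∏ i, σs i (x i) (y i)

/-- Separability of a `k`-partite state: a finite convex combination of product states. -/
def IsSeparable {k : ℕ} {ι : Fin k → Type*} [∀ i, Fintype (ι i)]
    (ρ : Matrix (∀ i, ι i) (∀ i, ι i) ℂ) : Prop :=
  ∃ (m : ℕ) (p : Fin m → ℝ) (σs : Fin m → ∀ i, Matrix (ι i) (ι i) ℂ),
    (∀ j, 0 ≤ p j) ∧ (∑ j, p j = 1) ∧ (∀ j i, IsState (σs j i)) ∧
    ρ = ∑ j, p j • prodOp (σs j)

/-- Relative entropy of entanglement `E_R(ρ) = inf {S(ρ‖ω) : ω separable}`. -/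
def ERel {k : ℕ} {ι : Fin k → Type*} [∀ i, Fintype (ι i)] [∀ i, DecidableEq (ι i)]
    (ρ : Matrix (∀ i, ι i) (∀ i, ι i) ℂ) : ℝ :=
  sInf {x | ∃ ω, IsSeparable ω ∧ SuppLe ρ ω ∧ x = relEnt ρ ω}

/-- `ρ^{⊗n}` of a `k`-partite state, viewed as a `k`-partite state where the `i`-th
party holds the `n` copies of its system. -/
def tpowMulti {k : ℕ} {d : Fin k → ℕ} (ρ : Matrix (∀ i, Fin (d i)) (∀ i, Fin (d i)) ℂ)
    (n : ℕ) : Matrix (∀ i, Fin n → Fin (d i)) (∀ i, Fin n → Fin (d i)) ℂ :=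
  fun x y => ∏ t : Fin n, ρ (fun i => x i t) (fun i => y i t)

/-- `ρ^{⊗n}` of a bipartite state in the grouped bipartition `A^{⊗n} : B^{⊗n}`. -/
def tpowBi {A B : Type*} [Fintype A] [Fintype B]
    (ρ : Matrix (A × B) (A × B) ℂ) (n : ℕ) :
    Matrix ((Fin n → A) × (Fin n → B)) ((Fin n → A) × (Fin n → B)) ℂ :=
  fun x y => ∏ i, ρ (x.1 i, x.2 i) (y.1 i, y.2 i)

/-- `k`-extendibility of a bipartite state. -/
def IsKExtendible {A B : Type*} [Fintype A] [Fintype B] (k : ℕ)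
    (σ : Matrix (A × B) (A × B) ℂ) : Prop :=
  ∃ σ' : Matrix (A × (Fin k → B)) (A × (Fin k → B)) ℂ,
    IsState σ' ∧
    (∀ (π : Equiv.Perm (Fin k)) (p q : A × (Fin k → B)),
      σ' (p.1, p.2 ∘ π) (q.1, q.2 ∘ π) = σ' p q) ∧
    (∀ p q : A × B, σ p q =
      ∑ f : {i : Fin k // (i : ℕ) ≠ 0} → B,
        σ' (p.1, fun i => if h : (i : ℕ) = 0 then p.2 else f ⟨i, h⟩)
           (q.1, fun i => if h : (i : ℕ) = 0 then q.2 else f ⟨i, h⟩))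

open scoped Matrix

lemma re_trace_nonneg {n : Type*} [Fintype n] {A : Matrix n n ℂ} (hA : A.PosSemidef) :
    0 ≤ A.trace.re :=
  (Complex.le_def.1 hA.trace_nonneg).1

lemma re_trace_conjTranspose {n : Type*} [Fintype n] (A : Matrix n n ℂ) :
    Aᴴ.trace.re = A.trace.re := by
  simp [Matrix.trace_conjTranspose]

/-- Cauchy–Schwarz inequality for the Hilbert–Schmidt inner product. -/
lemma re_trace_mul_le {n : Type*} [Fintype n] (A B : Matrix n n ℂ) :
    (A * B).trace.re ≤ √(A * Aᴴ).trace.re * √(Bᴴ * B).trace.re := by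
  have hA : (A * Aᴴ).trace.re = ∑ p : n × n, ‖A p.1 p.2‖ ^ 2 := by
    simp [Matrix.trace, Matrix.mul_apply, Fintype.sum_prod_type, ← Complex.normSq_eq_norm_sq,
      Complex.normSq_apply]
  have hB : (Bᴴ * B).trace.re = ∑ p : n × n, ‖B p.2 p.1‖ ^ 2 := by
    simp [Matrix.trace, Matrix.mul_apply, Fintype.sum_prod_type, ← Complex.normSq_eq_norm_sq,
      Complex.normSq_apply]
  rw [hA, hB]
  refine le_trans ?_ (Real.sum_mul_le_sqrt_mul_sqrt _ _ _)
  simp only [Matrix.trace, Matrix.diag_apply, Matrix.mul_apply, Fintype.sum_prod_type,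
    Complex.re_sum]
  refine Finset.sum_le_sum fun i _ => Finset.sum_le_sum fun j _ => ?_
  exact (Complex.re_le_norm _).trans (norm_mul _ _).le

lemma fcal_mul_fcal (f g : ℝ → ℝ) (A : Matrix I I ℂ) :
    fcal f A * fcal g A = fcal (fun x => f x * g x) A := by
  unfold fcal
  split_ifs with hA
  · have hU : star (hA.eigenvectorUnitary : Matrix I I ℂ) * hA.eigenvectorUnitary = 1 :=
      Unitary.coe_star_mul_self _
    simp only [Complex.ofReal_mul, ← Matrix.diagonal_mul_diagonal, Matrix.mul_assoc]
    rw [← Matrix.mul_assoc (star (hA.eigenvectorUnitary : Matrix I I ℂ)), hU, Matrix.one_mul]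
  · simp

lemma fcal_congr_of_posSemidef {f g : ℝ → ℝ} {A : Matrix I I ℂ} (hA : A.PosSemidef)
    (h : ∀ x, 0 ≤ x → f x = g x) : fcal f A = fcal g A := by
  unfold fcal
  rw [dif_pos hA.isHermitian, dif_pos hA.isHermitian]
  simp only [h _ (hA.eigenvalues_nonneg _)]

lemma fcal_id {A : Matrix I I ℂ} (hA : A.IsHermitian) : fcal (fun x => x) A = A := by
  unfold fcal
  rw [dif_pos hA]
  exact hA.spectral_theorem.symm

lemma fcal_posSemidef {f : ℝ → ℝ} (hf : ∀ x, 0 ≤ f x) (A : Matrix I I ℂ) :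
    (fcal f A).PosSemidef := by
  unfold fcal
  split_ifs with hA
  · refine Matrix.PosSemidef.mul_mul_conjTranspose_same (Matrix.PosSemidef.diagonal ?_) _
    intro i
    simpa using hf _
  · exact Matrix.PosSemidef.zero

lemma one_sub_fcal_posSemidef {f : ℝ → ℝ} (hf : ∀ x, f x ≤ 1) {A : Matrix I I ℂ}
    (hA : A.IsHermitian) : (1 - fcal f A).PosSemidef := by
  have h : 1 - fcal f A = fcal (fun x => 1 - f x) A := by
    have hU : (hA.eigenvectorUnitary : Matrix I I ℂ) * star (hA.eigenvectorUnitary : Matrix I I ℂ)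
        = 1 := Unitary.coe_mul_star_self _
    unfold fcal
    rw [dif_pos hA, dif_pos hA]
    simp only [Complex.ofReal_sub, Complex.ofReal_one, ← Matrix.diagonal_sub, Matrix.diagonal_one,
      Matrix.mul_sub, Matrix.sub_mul, Matrix.mul_one, hU]
  rw [h]
  exact fcal_posSemidef (fun x => sub_nonneg.2 (hf x)) A

lemma msqrt_posSemidef (A : Matrix I I ℂ) : (msqrt A).PosSemidef :=
  fcal_posSemidef Real.sqrt_nonneg A

lemma msqrt_mul_msqrt {A : Matrix I I ℂ} (hA : A.PosSemidef) : msqrt A * msqrt A = A := by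
  unfold msqrt
  rw [fcal_mul_fcal]
  conv_rhs => rw [← fcal_id hA.isHermitian]
  exact fcal_congr_of_posSemidef hA fun x hx => Real.mul_self_sqrt hx

section Monotone

open scoped MatrixOrder Matrix.Norms.L2Operator

lemma msqrt_sub_msqrt_posSemidef {A B : Matrix I I ℂ} (hA : A.PosSemidef) (hB : B.PosSemidef)
    (h : (B - A).PosSemidef) : (msqrt B - msqrt A).PosSemidef := by
  have hsqrt : ∀ C : Matrix I I ℂ, C.PosSemidef → CFC.sqrt C = msqrt C := fun C hC =>
    CFC.sqrt_unique (msqrt_mul_msqrt hC) (msqrt_posSemidef C).nonneg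
  rw [← hsqrt A hA, ← hsqrt B hB]
  exact CFC.sqrt_le_sqrt A B h

end Monotone

/-- The inverse square root of a positive semidefinite matrix, computed on its support. -/
def invSqrt (A : Matrix I I ℂ) : Matrix I I ℂ := fcal (fun x => (Real.sqrt x)⁻¹) A

/-- The orthogonal projection onto the support of a positive semidefinite matrix. -/
def suppProj (A : Matrix I I ℂ) : Matrix I I ℂ :=
  fcal (fun x => if Real.sqrt x = 0 then 0 else 1) A

lemma invSqrt_isHermitian (A : Matrix I I ℂ) : (invSqrt A)ᴴ = invSqrt A :=
  (fcal_posSemidef (fun x => inv_nonneg.2 (Real.sqrt_nonneg x)) A).isHermitian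

lemma suppProj_isHermitian (A : Matrix I I ℂ) : (suppProj A)ᴴ = suppProj A :=
  (fcal_posSemidef (fun x => by split_ifs <;> norm_num) A).isHermitian

lemma one_sub_suppProj_posSemidef {A : Matrix I I ℂ} (hA : A.PosSemidef) :
    (1 - suppProj A).PosSemidef :=
  one_sub_fcal_posSemidef (fun x => by split_ifs <;> norm_num) hA.isHermitian

lemma invSqrt_mul_msqrt (A : Matrix I I ℂ) : invSqrt A * msqrt A = suppProj A := by
  unfold invSqrt msqrt suppProj
  rw [fcal_mul_fcal]
  congr 1
  funext x
  split_ifs with h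
  · simp [h]
  · exact inv_mul_cancel₀ h

lemma msqrt_mul_invSqrt (A : Matrix I I ℂ) : msqrt A * invSqrt A = suppProj A := by
  have h := congrArg Matrix.conjTranspose (invSqrt_mul_msqrt A)
  rwa [Matrix.conjTranspose_mul, invSqrt_isHermitian, suppProj_isHermitian,
    (msqrt_posSemidef A).isHermitian.eq] at h

lemma suppProj_mul_msqrt (A : Matrix I I ℂ) : suppProj A * msqrt A = msqrt A := by
  unfold msqrt suppProj
  rw [fcal_mul_fcal]
  congr 1
  funext x
  split_ifs with h <;> simp [h]

lemma suppProj_mul_self (A : Matrix I I ℂ) : suppProj A * suppProj A = suppProj A := by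
  unfold suppProj
  rw [fcal_mul_fcal]
  congr 1
  funext x
  split_ifs <;> simp

lemma suppProj_mul {A : Matrix I I ℂ} (hA : A.PosSemidef) : suppProj A * A = A := by
  calc suppProj A * A = suppProj A * (msqrt A * msqrt A) := by rw [msqrt_mul_msqrt hA]
    _ = A := by rw [← Matrix.mul_assoc, suppProj_mul_msqrt, msqrt_mul_msqrt hA]

lemma invSqrt_mul_mul_invSqrt {A : Matrix I I ℂ} (hA : A.PosSemidef) :
    invSqrt A * A * invSqrt A = suppProj A := by
  calc invSqrt A * A * invSqrt A = invSqrt A * (msqrt A * msqrt A) * invSqrt A := by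
        rw [msqrt_mul_msqrt hA]
    _ = suppProj A := by
        rw [← Matrix.mul_assoc, invSqrt_mul_msqrt, Matrix.mul_assoc, msqrt_mul_invSqrt,
          suppProj_mul_self]

/-- The support projection of `A` fixes every `B` with `B * Bᴴ ≤ A`. -/
lemma suppProj_mul_of_le {A B : Matrix I I ℂ} (hA : A.PosSemidef)
    (h : (A - B * Bᴴ).PosSemidef) : suppProj A * B = B := by
  set X := (1 - suppProj A) * B with hX
  have hzero : (1 - suppProj A) * A = 0 := by
    rw [Matrix.sub_mul, Matrix.one_mul, suppProj_mul hA, sub_self]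
  have hneg : (-(X * Xᴴ)).PosSemidef := by
    have := h.mul_mul_conjTranspose_same (1 - suppProj A)
    rw [Matrix.mul_sub, hzero, zero_sub, Matrix.neg_mul] at this
    simpa [hX, Matrix.mul_assoc] using this
  have htrace : (X * Xᴴ).trace = 0 := by
    refine le_antisymm ?_ (Matrix.posSemidef_self_mul_conjTranspose X).trace_nonneg
    simpa [Matrix.trace_neg] using hneg.trace_nonneg
  have hX0 : X = 0 := Matrix.trace_mul_conjTranspose_self_eq_zero_iff.1 htrace
  rw [hX, Matrix.sub_mul, Matrix.one_mul, sub_eq_zero] at hX0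
  exact hX0.symm

lemma re_trace_mul_nonneg {A B : Matrix I I ℂ} (hA : A.PosSemidef) (hB : B.PosSemidef) :
    0 ≤ (A * B).trace.re := by
  have hQ := (msqrt_posSemidef A).isHermitian
  have h := hB.mul_mul_conjTranspose_same (msqrt A)
  rw [hQ.eq] at h
  have h' := re_trace_nonneg h
  rwa [Matrix.trace_mul_comm, ← Matrix.mul_assoc, msqrt_mul_msqrt hA] at h'

/-- `|tr M| ≤ ‖M‖₁`, for the real part. -/
lemma re_trace_le_re_trace_msqrt (M : Matrix I I ℂ) :
    M.trace.re ≤ (msqrt (M * Mᴴ)).trace.re := by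
  have hA : (M * Mᴴ).PosSemidef := Matrix.posSemidef_self_mul_conjTranspose M
  have hP : (msqrt (M * Mᴴ)).PosSemidef := msqrt_posSemidef _
  set P := msqrt (M * Mᴴ)
  set G := invSqrt (M * Mᴴ)
  have hG : Gᴴ = G := invSqrt_isHermitian _
  set Q := msqrt P
  have hQ : Qᴴ = Q := (msqrt_posSemidef P).isHermitian
  have hQQ : Q * Q = P := msqrt_mul_msqrt hP
  have hM : P * G * M = M := by
    rw [msqrt_mul_invSqrt]
    exact suppProj_mul_of_le hA (by rw [sub_self]; exact Matrix.PosSemidef.zero)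
  have hCS := re_trace_mul_le Q (Q * (G * M))
  have h₁ : Q * (Q * (G * M)) = M := by
    rw [← Matrix.mul_assoc, hQQ, ← Matrix.mul_assoc, hM]
  have h₂ : ((Q * (G * M))ᴴ * (Q * (G * M))).trace.re ≤ P.trace.re := by
    have h₃ : ((Q * (G * M))ᴴ * (Q * (G * M))).trace = (P * suppProj (M * Mᴴ)).trace := by
      rw [Matrix.trace_mul_comm, ← invSqrt_mul_mul_invSqrt hA, ← hQQ, Matrix.mul_assoc Q Q,
        Matrix.trace_mul_comm Q (Q * _)]
      simp only [Matrix.conjTranspose_mul, hG, hQ, Matrix.mul_assoc, G]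
    have h₄ := re_trace_mul_nonneg hP (one_sub_suppProj_posSemidef hA)
    rw [Matrix.mul_sub, Matrix.mul_one, Matrix.trace_sub, Complex.sub_re] at h₄
    rw [h₃]
    linarith
  rw [h₁, hQ, hQQ] at hCS
  calc M.trace.re ≤ _ := hCS
    _ ≤ √P.trace.re * √P.trace.re := by gcongr
    _ = P.trace.re := Real.mul_self_sqrt (re_trace_nonneg hP)

/-- The trace norm is attained as a pairing with a contraction. -/
lemma exists_trNorm_eq (X : Matrix I I ℂ) :
    ∃ K : Matrix I I ℂ, (1 - K * Kᴴ).PosSemidef ∧ trNorm X = (K * X).trace.re := by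
  have hA : (Xᴴ * X).PosSemidef := Matrix.posSemidef_conjTranspose_mul_self X
  refine ⟨invSqrt (Xᴴ * X) * Xᴴ, ?_, ?_⟩
  · have h : invSqrt (Xᴴ * X) * Xᴴ * (invSqrt (Xᴴ * X) * Xᴴ)ᴴ = suppProj (Xᴴ * X) := by
      rw [← invSqrt_mul_mul_invSqrt hA]
      simp only [Matrix.conjTranspose_mul, Matrix.conjTranspose_conjTranspose, invSqrt_isHermitian,
        Matrix.mul_assoc]
    rw [h]
    exact one_sub_suppProj_posSemidef hA
  · unfold trNorm
    have h : invSqrt (Xᴴ * X) * (Xᴴ * X) = msqrt (Xᴴ * X) := by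
      calc _ = invSqrt (Xᴴ * X) * (msqrt (Xᴴ * X) * msqrt (Xᴴ * X)) := by
            rw [msqrt_mul_msqrt hA]
        _ = msqrt (Xᴴ * X) := by
            rw [← Matrix.mul_assoc, invSqrt_mul_msqrt, suppProj_mul_msqrt]
    rw [Matrix.mul_assoc, h]

/-- Hölder-type bound for the pairing of a contraction with a product. -/
lemma re_trace_contraction_mul_le {K : Matrix I I ℂ} (hK : (1 - K * Kᴴ).PosSemidef)
    (C D : Matrix I I ℂ) :
    (K * (C * D)).trace.re ≤ √(Dᴴ * D).trace.re * √(Cᴴ * C).trace.re := by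
  have h : (K * (C * D)).trace = (D * K * C).trace := by
    rw [Matrix.mul_assoc D, Matrix.trace_mul_comm D, Matrix.mul_assoc]
  rw [h]
  refine (re_trace_mul_le (D * K) C).trans ?_
  refine mul_le_mul_of_nonneg_right (Real.sqrt_le_sqrt ?_) (Real.sqrt_nonneg _)
  have h' := re_trace_nonneg (hK.mul_mul_conjTranspose_same D)
  rw [Matrix.mul_sub, Matrix.sub_mul, Matrix.mul_one, Matrix.trace_sub, Complex.sub_re,
    Matrix.trace_mul_comm D Dᴴ] at h'
  simp only [Matrix.conjTranspose_mul, Matrix.mul_assoc] at h' ⊢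
  linarith

/-- For `0 ≤ Y ≤ Z` there is a contraction `T` (namely `Y^{1/2} Z^{-1/2}`) with `T Z Tᴴ = Y`
and `tr Y ≤ Re tr (T Z)`. -/
lemma exists_contraction {Y Z : Matrix I I ℂ} (hY : Y.PosSemidef) (hZ : Z.PosSemidef)
    (h : (Z - Y).PosSemidef) :
    ∃ T : Matrix I I ℂ, (1 - Tᴴ * T).PosSemidef ∧ T * Z * Tᴴ = Y ∧
      Y.trace.re ≤ (T * Z).trace.re := by
  have hR : (msqrt Y)ᴴ = msqrt Y := (msqrt_posSemidef Y).isHermitian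
  have hG := invSqrt_isHermitian Z
  have hProj : suppProj Z * msqrt Y = msqrt Y :=
    suppProj_mul_of_le hZ (by rwa [hR, msqrt_mul_msqrt hY])
  have hProj' : msqrt Y * suppProj Z = msqrt Y := by
    have := congrArg Matrix.conjTranspose hProj
    rwa [Matrix.conjTranspose_mul, hR, suppProj_isHermitian] at this
  have hTS : msqrt Y * invSqrt Z * msqrt Z = msqrt Y := by
    rw [Matrix.mul_assoc, invSqrt_mul_msqrt, hProj']
  have hTZ : msqrt Y * invSqrt Z * Z = msqrt Y * msqrt Z := by
    calc msqrt Y * invSqrt Z * Z = msqrt Y * invSqrt Z * (msqrt Z * msqrt Z) := by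
          rw [msqrt_mul_msqrt hZ]
      _ = msqrt Y * msqrt Z := by rw [← Matrix.mul_assoc, hTS]
  have hT : (msqrt Y * invSqrt Z)ᴴ = invSqrt Z * msqrt Y := by
    rw [Matrix.conjTranspose_mul, hR, hG]
  refine ⟨msqrt Y * invSqrt Z, ?_, ?_, ?_⟩
  · have hsum := (one_sub_suppProj_posSemidef hZ).add (h.mul_mul_conjTranspose_same (invSqrt Z))
    have heq : (msqrt Y * invSqrt Z)ᴴ * (msqrt Y * invSqrt Z) = invSqrt Z * Y * invSqrt Z := by
      rw [hT, Matrix.mul_assoc, ← Matrix.mul_assoc (msqrt Y), msqrt_mul_msqrt hY, Matrix.mul_assoc]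
    rw [hG, Matrix.mul_sub, Matrix.sub_mul, invSqrt_mul_mul_invSqrt hZ, sub_add_sub_cancel] at hsum
    rwa [heq]
  · rw [hTZ, hT, Matrix.mul_assoc, ← Matrix.mul_assoc (msqrt Z), msqrt_mul_invSqrt, hProj,
      msqrt_mul_msqrt hY]
  · have := re_trace_mul_nonneg (msqrt_posSemidef Y) (msqrt_sub_msqrt_posSemidef hY hZ h)
    rw [Matrix.mul_sub, msqrt_mul_msqrt hY, Matrix.trace_sub, Complex.sub_re] at this
    rw [hTZ]
    linarith

/-- **Lemma (Datta–Renner).**  If `ρ ≤ Y + Δ` with `Y, Δ ≥ 0` and `tr Δ < 1`, then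
there is a state `ρ̃` with `ρ̃ ≤ (1 − tr Δ)⁻¹ Y`, `F(ρ, ρ̃) ≥ 1 − tr Δ` and
`‖ρ − ρ̃‖₁ ≤ 4 √(tr Δ)`. -/
theorem datta_renner {d : ℕ} (ρ Y Δ : Matrix (Fin d) (Fin d) ℂ)
    (hρ : IsState ρ) (hY : Y.PosSemidef) (hΔ : Δ.PosSemidef)
    (hle : (Y + Δ - ρ).PosSemidef) (htr : (Δ.trace).re < 1) :
    ∃ ρ' : Matrix (Fin d) (Fin d) ℂ, IsState ρ' ∧
      ((((1 - (Δ.trace).re)⁻¹) • Y - ρ').PosSemidef) ∧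
      1 - (Δ.trace).re ≤ fid ρ ρ' ∧
      trNorm (ρ - ρ') ≤ 4 * Real.sqrt ((Δ.trace).re) := by
  obtain ⟨T, hT, hTZ, htrT⟩ := exists_contraction hY (hY.add hΔ)
    (by rwa [add_sub_cancel_left])
  set δ := Δ.trace.re with hδ
  have hδ0 : 0 ≤ δ := re_trace_nonneg hΔ
  obtain ⟨hρ0, hρ1⟩ := hρ
  have hQ : (msqrt ρ)ᴴ = msqrt ρ := (msqrt_posSemidef ρ).isHermitian
  have hQQ : msqrt ρ * msqrt ρ = ρ := msqrt_mul_msqrt hρ0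
  have hσ : (T * ρ * Tᴴ).PosSemidef := hρ0.mul_mul_conjTranspose_same T
  set s := (T * ρ * Tᴴ).trace.re with hs
  have htrσ : (T * ρ * Tᴴ).trace = (s : ℂ) :=
    (Complex.ext rfl (by simpa using (Complex.le_def.1 hσ.trace_nonneg).2.symm))
  have htrZ : (Y + Δ).trace.re = Y.trace.re + δ := by rw [Matrix.trace_add, Complex.add_re]
  have hcyc : ∀ X : Matrix (Fin d) (Fin d) ℂ,
      (X * (1 - Tᴴ * T)).trace.re = X.trace.re - (T * X * Tᴴ).trace.re := by
    intro X
    rw [Matrix.mul_sub, Matrix.mul_one, Matrix.trace_sub, Complex.sub_re, Matrix.mul_assoc T,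
      Matrix.trace_mul_comm T, Matrix.mul_assoc]
  have hs_le : s ≤ 1 := by
    have h := re_trace_mul_nonneg hρ0 hT
    rw [hcyc, hρ1] at h
    simpa using h
  have hs_ge : 1 - δ ≤ s := by
    have h := re_trace_mul_nonneg hle hT
    rw [Matrix.sub_mul, Matrix.trace_sub, Complex.sub_re, hcyc, hcyc, hTZ, hρ1, htrZ,
      Complex.one_re] at h
    linarith
  have hs0 : 0 < s := by linarith
  have hre : ∀ X : Matrix (Fin d) (Fin d) ℂ, X.IsHermitian →
      (X * ((1 - T)ᴴ * (1 - T) + (1 - Tᴴ * T))).trace.re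
        = 2 * X.trace.re - 2 * (T * X).trace.re := by
    intro X hX
    have h₁ : (1 - T)ᴴ * (1 - T) + (1 - Tᴴ * T) = (1 - T) + (1 - Tᴴ) := by
      rw [Matrix.conjTranspose_sub, Matrix.conjTranspose_one]
      noncomm_ring
    have h₂ : (X * Tᴴ).trace.re = (T * X).trace.re := by
      rw [← re_trace_conjTranspose (T * X), Matrix.conjTranspose_mul, hX.eq]
    rw [h₁, Matrix.mul_add, Matrix.mul_sub, Matrix.mul_sub, Matrix.mul_one, Matrix.trace_add,
      Matrix.trace_sub, Matrix.trace_sub, Complex.add_re, Complex.sub_re, Complex.sub_re, h₂,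
      Matrix.trace_mul_comm X T]
    ring
  have htrTρ : 1 - δ ≤ (T * ρ).trace.re := by
    have h := re_trace_mul_nonneg hle
      ((Matrix.posSemidef_conjTranspose_mul_self (1 - T)).add hT)
    rw [hre _ hle.isHermitian, Matrix.mul_sub, Matrix.trace_sub, Matrix.trace_sub, Complex.sub_re,
      Complex.sub_re, hρ1, htrZ, Complex.one_re] at h
    linarith
  have hdist : (((1 - T) * msqrt ρ)ᴴ * ((1 - T) * msqrt ρ)).trace.re ≤ 2 * δ := by
    have h := hre ρ hρ0.isHermitian
    rw [Matrix.mul_add, Matrix.trace_add, Complex.add_re, hρ1, Complex.one_re] at h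
    have h' := re_trace_mul_nonneg hρ0 hT
    have heq : (((1 - T) * msqrt ρ)ᴴ * ((1 - T) * msqrt ρ)).trace
        = (ρ * ((1 - T)ᴴ * (1 - T))).trace := by
      conv_rhs => rw [← hQQ]
      rw [Matrix.mul_assoc (msqrt ρ), Matrix.trace_mul_comm (msqrt ρ), Matrix.conjTranspose_mul, hQ]
      simp only [Matrix.mul_assoc]
    rw [heq]
    linarith
  have hTQ : ((T * msqrt ρ)ᴴ * (T * msqrt ρ)).trace.re = s := by
    rw [Matrix.trace_mul_comm, hs, Matrix.conjTranspose_mul, hQ, Matrix.mul_assoc,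
      ← Matrix.mul_assoc (msqrt ρ), hQQ, Matrix.mul_assoc]
  refine ⟨s⁻¹ • (T * ρ * Tᴴ), ⟨hσ.smul (inv_nonneg.2 hs0.le), ?_⟩, ?_, ?_, ?_⟩
  · rw [Matrix.trace_smul, htrσ, Complex.real_smul, ← Complex.ofReal_mul, inv_mul_cancel₀ hs0.ne',
      Complex.ofReal_one]
  · have h₁ : (Y - T * ρ * Tᴴ).PosSemidef := by
      have h := hle.mul_mul_conjTranspose_same T
      rwa [Matrix.mul_sub, Matrix.sub_mul, hTZ] at h
    have h₂ := (h₁.smul (inv_nonneg.2 hs0.le)).add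
      (hY.smul (sub_nonneg.2 (inv_anti₀ (by linarith) hs_ge)))
    convert h₂ using 1
    rw [smul_sub, sub_smul]
    abel
  · have hM : msqrt ρ * (s⁻¹ • (T * ρ * Tᴴ)) * msqrt ρ
        = ((√s)⁻¹ • (msqrt ρ * T * msqrt ρ)) * ((√s)⁻¹ • (msqrt ρ * T * msqrt ρ))ᴴ := by
      have hinv : s⁻¹ = (√s)⁻¹ * (√s)⁻¹ := by rw [← mul_inv, Real.mul_self_sqrt hs0.le]
      rw [hinv]
      simp only [Matrix.conjTranspose_smul, Matrix.conjTranspose_mul, hQ, Matrix.mul_smul,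
        Matrix.smul_mul, smul_smul, star_trivial, Matrix.mul_assoc]
      rw [← Matrix.mul_assoc (msqrt ρ) (msqrt ρ), hQQ]
    have h := re_trace_le_re_trace_msqrt ((√s)⁻¹ • (msqrt ρ * T * msqrt ρ))
    rw [← hM, Matrix.trace_smul, Matrix.trace_mul_comm, ← Matrix.mul_assoc, hQQ,
      Matrix.trace_mul_comm, Complex.smul_re, smul_eq_mul] at h
    refine le_trans ?_ h
    have hsq : 1 ≤ (√s)⁻¹ := (one_le_inv₀ (Real.sqrt_pos.2 hs0)).2 (Real.sqrt_le_one.2 hs_le)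
    nlinarith
  · obtain ⟨K, hK, hKeq⟩ := exists_trNorm_eq (ρ - s⁻¹ • (T * ρ * Tᴴ))
    have hsplit : ρ - s⁻¹ • (T * ρ * Tᴴ) = ((1 - T) * msqrt ρ) * msqrt ρ
        + (T * msqrt ρ) * ((1 - T) * msqrt ρ)ᴴ
        + (-(s⁻¹ - 1)) • ((T * msqrt ρ) * (T * msqrt ρ)ᴴ) := by
      have h₁ : (T * msqrt ρ) * ((1 - T) * msqrt ρ)ᴴ = T * ρ - T * ρ * Tᴴ := by
        rw [Matrix.conjTranspose_mul, hQ, Matrix.mul_assoc, ← Matrix.mul_assoc (msqrt ρ), hQQ,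
          Matrix.conjTranspose_sub, Matrix.conjTranspose_one, Matrix.mul_sub, Matrix.mul_one,
          Matrix.mul_sub, Matrix.mul_assoc]
      have h₂ : (T * msqrt ρ) * (T * msqrt ρ)ᴴ = T * ρ * Tᴴ := by
        rw [Matrix.conjTranspose_mul, hQ, Matrix.mul_assoc, ← Matrix.mul_assoc (msqrt ρ), hQQ,
          Matrix.mul_assoc]
      rw [h₁, h₂, Matrix.mul_assoc (1 - T), hQQ, Matrix.sub_mul, Matrix.one_mul, neg_smul, sub_smul,
        one_smul]
      abel
    have hb₁ := re_trace_contraction_mul_le hK ((1 - T) * msqrt ρ) (msqrt ρ)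
    have hb₂ := re_trace_contraction_mul_le hK (T * msqrt ρ) ((1 - T) * msqrt ρ)ᴴ
    have hb₃ := re_trace_contraction_mul_le hK (-(T * msqrt ρ)) (T * msqrt ρ)ᴴ
    have hcomm : ∀ X : Matrix (Fin d) (Fin d) ℂ, (Xᴴᴴ * Xᴴ).trace = (Xᴴ * X).trace := fun X => by
      rw [Matrix.conjTranspose_conjTranspose, Matrix.trace_mul_comm]
    rw [hQ, hQQ, hρ1, Complex.one_re, Real.sqrt_one, one_mul] at hb₁
    rw [hcomm, hTQ] at hb₂
    rw [hcomm, Matrix.conjTranspose_neg, neg_mul_neg, hTQ, Real.mul_self_sqrt hs0.le,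
      Matrix.neg_mul, Matrix.mul_neg, Matrix.trace_neg, Complex.neg_re] at hb₃
    have hc := Real.sqrt_le_sqrt hdist
    set c := √(((1 - T) * msqrt ρ)ᴴ * ((1 - T) * msqrt ρ)).trace.re
    have hc0 : 0 ≤ c := Real.sqrt_nonneg _
    have hb₂' : c * √s ≤ c := mul_le_of_le_one_right hc0 (Real.sqrt_le_one.2 hs_le)
    have hb₃' := mul_le_mul_of_nonneg_left hb₃ (sub_nonneg.2 ((one_le_inv₀ hs0).2 hs_le))
    rw [sub_mul s⁻¹ 1 s, inv_mul_cancel₀ hs0.ne', one_mul] at hb₃'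
    have h2δ : √(2 * δ) ≤ 3 / 2 * √δ := by
      rw [Real.sqrt_le_left (by positivity), mul_pow, Real.sq_sqrt hδ0]
      linarith
    have hδsqrt : δ ≤ √δ := Real.le_sqrt_of_sq_le (by nlinarith)
    rw [hKeq, hsplit, Matrix.mul_add, Matrix.mul_add, Matrix.trace_add, Matrix.trace_add,
      Complex.add_re, Complex.add_re, Matrix.mul_smul, Matrix.trace_smul, Complex.smul_re,
      smul_eq_mul]
    linarith
end GQSL
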